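/- arXiv:2112.12276 — 14 statements merged into one kernel-verified Lean document; each statement's English description precedes it below -/
import Mathlib

section
/- For all real numbers a and b with 0 ≤ a < 1 and 0 ≤ b < 1, one has (4−a)·(3−b)·(1−b)·(9a−12b) − 6·(4−a)²·(3−b) + (3−b)³·(−35/2 + (9/2)·b + 4a) − (1/2)·(22 + (5/2)·a)·(2 − a/2)³ < 0. -/
/-- Case E1 (blow-up of a quadric at a point): the explicit upper bound for
`β'_{(X,D)}(D₂)` is negative for all boundary coefficients `0 ≤ a, b < 1`. -/
theorem stmt_0 (a b : ℝ) (ha0 : 0 ≤ a) (ha1 : a < 1) (hb0 : 0 ≤ b) (hb1 : b < 1) :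
    (4 - a) * (3 - b) * (1 - b) * (9 * a - 12 * b) - 6 * (4 - a) ^ 2 * (3 - b)
      + (3 - b) ^ 3 * (-35 / 2 + (9 / 2) * b + 4 * a)
      - (1 / 2) * (22 + (5 / 2) * a) * (2 - a / 2) ^ 3 < 0 := by
  have h1 : (1 - b) * (9 * a - 12 * b) ≤ 9 * a := by
    nlinarith [mul_nonneg ha0 hb0, mul_nonneg hb0 (sub_nonneg.2 hb1.le)]
  have h2 : 0 < (4 - a) * (3 - b) := mul_pos (by linarith) (by linarith)
  have h3 : 0 < (4 - a) * (3 - b) * (6 * (4 - a) - (1 - b) * (9 * a - 12 * b)) :=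
    mul_pos h2 (by linarith)
  have h4 : 0 < (3 - b) ^ 3 * (35 / 2 - (9 / 2) * b - 4 * a) :=
    mul_pos (pow_pos (by linarith) 3) (by linarith)
  have h5 : 0 < (1 / 2) * (22 + (5 / 2) * a) * (2 - a / 2) ^ 3 :=
    mul_pos (by linarith) (pow_pos (by linarith) 3)
  linarith
end

section
/- Let n ≥ 1 be an integer and let a, b be real numbers with 0 ≤ a < 1, 0 < b < 1 and n·(1−b) < 1. Set T = 3−a−b and define β₁ = T³·(n+1)·(1−3a+b)/4 + T²·(1−n+b·n)·(b−2a), β₂ = (1−2n)·T³·(1−3b+a)/4 + T²·(1+2n−a·n)·(a−2b), and β₃ = T³·(n−2)·(1+a+b)/4 + T²·(4−a−n+b·(n−1))·(a+b). Then at least one of β₁, β₂, β₃ is strictly negative. -/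
/-- Case D2: for `X = P_{P¹}(O ⊕ O(1) ⊕ O(n))` with boundary `D = aD₁ + bD₂`
(`D₁ ∼ H`, `D₂ ∼ H − nF`), at least one of the beta-invariants
`β'_{(X,D)}(D₁)`, `β'_{(X,D)}(D₂)`, `β'_{(X,D)}(E)` is strictly negative. -/
theorem stmt_1 (n : ℕ) (hn : 1 ≤ n) (a b : ℝ)
    (ha0 : 0 ≤ a) (ha1 : a < 1) (hb0 : 0 < b) (hb1 : b < 1)
    (hamp : (n : ℝ) * (1 - b) < 1)
    (T β₁ β₂ β₃ : ℝ)
    (hT : T = 3 - a - b)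
    (h1 : β₁ = T ^ 3 * ((n : ℝ) + 1) * (1 - 3 * a + b) / 4
          + T ^ 2 * (1 - (n : ℝ) + b * (n : ℝ)) * (b - 2 * a))
    (h2 : β₂ = (1 - 2 * (n : ℝ)) * T ^ 3 * (1 - 3 * b + a) / 4
          + T ^ 2 * (1 + 2 * (n : ℝ) - a * (n : ℝ)) * (a - 2 * b))
    (h3 : β₃ = T ^ 3 * ((n : ℝ) - 2) * (1 + a + b) / 4
          + T ^ 2 * (4 - a - (n : ℝ) + b * ((n : ℝ) - 1)) * (a + b)) :
    β₁ < 0 ∨ β₂ < 0 ∨ β₃ < 0 := by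
  by_contra! h
  obtain ⟨g1, g2, g3⟩ := h
  have hs : β₁ + β₂ + β₃ = 0 := by
    rw [h1, h2, h3, hT]; ring
  have hTpos : 0 < T := by linarith
  have hT2 : 0 < T ^ 2 := by positivity
  have e1 : β₁ = 0 := by linarith
  have e3 : β₃ = 0 := by linarith
  rcases Nat.lt_or_ge n 2 with hlt | hge
  · have hn1 : n = 1 := by omega
    subst hn1
    have key : 2 * β₁ + 4 * β₃ = T ^ 2 * (b * (12 - 4 * a + 2 * b)) := by
      rw [h1, h3, hT]; push_cast; ring
    have : 0 < T ^ 2 * (b * (12 - 4 * a + 2 * b)) :=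
      mul_pos hT2 (mul_pos hb0 (by linarith))
    linarith
  · have hn2 : (2 : ℝ) ≤ n := by exact_mod_cast hge
    have p1 : 0 ≤ T ^ 3 * ((n : ℝ) - 2) * (1 + a + b) / 4 := by
      have : 0 ≤ (n : ℝ) - 2 := by linarith
      positivity
    have p2 : 0 < T ^ 2 * (4 - a - (n : ℝ) + b * ((n : ℝ) - 1)) * (a + b) :=
      mul_pos (mul_pos hT2 (by linarith)) (by linarith)
    linarith
end

section
/- Let n ≥ 1 be an integer and let a, b be real numbers with 0 ≤ a < 1 and 0 ≤ b < 1. Then (1−b)·(−2n·(3−a−b)³ + 3·(3−a−b)²·(2+2n−a−a·n)) − ∫₀^{3−a−b} (−2n·(3−a−b−x)³ + 3·(3−a−b−x)²·(2+2n−a−a·n)) dx = (1/2)·(3−a−b)²·(−a²·n − 2a² + 2abn + 4ab + 2an + 4a − 3b²·n + 2bn − 8b − 3n), and this quantity is strictly negative. -/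
/-- Case D4: the beta-invariant `β'_{(X,D)}(D₂)` for
`X = P_{P¹}(O ⊕ O ⊕ O(n))`, `D₁ ∼ H + F`, `D₂ ∼ H − nF`, equals the stated
polynomial and is strictly negative. -/
theorem stmt_2 (n : ℕ) (hn : 1 ≤ n) (a b : ℝ)
    (ha0 : 0 ≤ a) (ha1 : a < 1) (hb0 : 0 ≤ b) (hb1 : b < 1) :
    (1 - b) * (-2 * (n : ℝ) * (3 - a - b) ^ 3
        + 3 * (3 - a - b) ^ 2 * (2 + 2 * (n : ℝ) - a - a * (n : ℝ)))
      - ∫ x in (0:ℝ)..(3 - a - b),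
          (-2 * (n : ℝ) * (3 - a - b - x) ^ 3
            + 3 * (3 - a - b - x) ^ 2 * (2 + 2 * (n : ℝ) - a - a * (n : ℝ)))
    = (1 / 2) * (3 - a - b) ^ 2 *
        (-a ^ 2 * (n : ℝ) - 2 * a ^ 2 + 2 * a * b * (n : ℝ) + 4 * a * b
          + 2 * a * (n : ℝ) + 4 * a - 3 * b ^ 2 * (n : ℝ) + 2 * b * (n : ℝ)
          - 8 * b - 3 * (n : ℝ))
    ∧ (1 / 2) * (3 - a - b) ^ 2 *
        (-a ^ 2 * (n : ℝ) - 2 * a ^ 2 + 2 * a * b * (n : ℝ) + 4 * a * b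
          + 2 * a * (n : ℝ) + 4 * a - 3 * b ^ 2 * (n : ℝ) + 2 * b * (n : ℝ)
          - 8 * b - 3 * (n : ℝ)) < 0 := by
  have hn' : (1 : ℝ) ≤ (n : ℝ) := by exact_mod_cast hn
  generalize (n : ℝ) = m at *
  constructor
  · have hint : ∀ L c : ℝ, ∫ x in (0:ℝ)..L, (-2 * m * (L - x) ^ 3 + 3 * (L - x) ^ 2 * c)
        = -m * L ^ 4 / 2 + L ^ 3 * c := by
      intro L c
      have hd : ∀ x ∈ Set.uIcc (0:ℝ) L,
          HasDerivAt (fun x : ℝ => m / 2 * (L - x) ^ 4 - c * (L - x) ^ 3)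
            (-2 * m * (L - x) ^ 3 + 3 * (L - x) ^ 2 * c) x := by
        intro x _
        have h1 : HasDerivAt (fun x : ℝ => L - x) (-1) x := by
          simpa using (hasDerivAt_id x).const_sub L
        refine HasDerivAt.congr_deriv (((h1.pow 4).const_mul (m / 2)).sub ((h1.pow 3).const_mul c)) ?_
        norm_num
        ring
      rw [intervalIntegral.integral_eq_sub_of_hasDerivAt hd
        (Continuous.intervalIntegrable (by fun_prop) _ _)]
      ring
    rw [hint]
    ring
  · have hL : 0 < 3 - a - b := by linarith
    apply mul_neg_of_pos_of_neg (by positivity)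
    have h1 : 0 < (1 + b - a) ^ 2 := pow_pos (by linarith) 2
    have h2 : 0 ≤ (m - 1) * ((1 + b - a) ^ 2 + 2 * (1 - b) ^ 2) :=
      mul_nonneg (by linarith) (by positivity)
    nlinarith [h1, h2]
end

section
/- For all real numbers a and b with 0 ≤ a < 1 and 0 ≤ b < 1, one has 3·(1−a)·(3−a−b)²·(2−a) − ∫₀^{2−a} 3·(3−a−b−x)²·(2−a−x) dx = ((a−2)·(9a³ + 8·(2b−5) + 2a²·(8b−29) + 2a·(53−26b+3b²)))/4; moreover this quantity is strictly negative whenever 2/3 < a < 1. -/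
/-- Antiderivative computation for the volume integral. -/
theorem integral_aux (c d : ℝ) :
    (∫ x in (0:ℝ)..d, 3 * (c - x) ^ 2 * (d - x))
      = 3 * (c ^ 2 * d * d - (c ^ 2 + 2 * c * d) * d ^ 2 / 2 + (2 * c + d) * d ^ 3 / 3
          - d ^ 4 / 4) := by
  have h : ∀ x ∈ Set.uIcc (0:ℝ) d, HasDerivAt
      (fun x : ℝ => 3 * (c ^ 2 * d * x - (c ^ 2 + 2 * c * d) * x ^ 2 / 2
        + (2 * c + d) * x ^ 3 / 3 - x ^ 4 / 4)) (3 * (c - x) ^ 2 * (d - x)) x := by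
    intro x _
    have h1 := (hasDerivAt_id' x).const_mul (c ^ 2 * d)
    have h2 := ((hasDerivAt_pow 2 x).const_mul (c ^ 2 + 2 * c * d)).div_const 2
    have h3 := ((hasDerivAt_pow 3 x).const_mul (2 * c + d)).div_const 3
    have h4 := (hasDerivAt_pow 4 x).div_const 4
    have h5 := (((h1.sub h2).add h3).sub h4).const_mul 3
    refine h5.congr_deriv ?_
    norm_num
    ring
  rw [intervalIntegral.integral_eq_sub_of_hasDerivAt h
    (Continuous.intervalIntegrable (by fun_prop) _ _)]
  ring

/-- Case D5: the beta-invariant `β'_{(X,D)}(D₁)` for `X = P¹ × P²`,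
`D₁ ∼ H + F`, `D₂ ∼ H`, equals the stated polynomial, which is strictly
negative for `2/3 < a < 1`. -/
theorem stmt_3 (a b : ℝ) (ha0 : 0 ≤ a) (ha1 : a < 1) (hb0 : 0 ≤ b) (hb1 : b < 1) :
    3 * (1 - a) * (3 - a - b) ^ 2 * (2 - a)
      - (∫ x in (0:ℝ)..(2 - a), 3 * (3 - a - b - x) ^ 2 * (2 - a - x))
    = ((a - 2) * (9 * a ^ 3 + 8 * (2 * b - 5) + 2 * a ^ 2 * (8 * b - 29)
        + 2 * a * (53 - 26 * b + 3 * b ^ 2))) / 4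
    ∧ (2 / 3 < a →
        ((a - 2) * (9 * a ^ 3 + 8 * (2 * b - 5) + 2 * a ^ 2 * (8 * b - 29)
          + 2 * a * (53 - 26 * b + 3 * b ^ 2))) / 4 < 0) := by
  refine ⟨?_, fun h => ?_⟩
  · rw [integral_aux (3 - a - b) (2 - a)]
    ring
  · have key : 9 * a ^ 3 + 8 * (2 * b - 5) + 2 * a ^ 2 * (8 * b - 29)
        + 2 * a * (53 - 26 * b + 3 * b ^ 2)
        = 3 * (3 * a - 2) * (2 - a) ^ 2
          + (1 - b) * (8 * (2 * a - 1) * (2 - a) + 6 * a * (1 - b)) := by ring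
    rw [key]
    have e1 : 0 < 3 * a - 2 := by linarith
    have e2 : 0 < 2 - a := by linarith
    have e3 : 0 < 1 - b := by linarith
    have e4 : 0 < 2 * a - 1 := by linarith
    have e5 : 0 < 3 * (3 * a - 2) * (2 - a) ^ 2
          + (1 - b) * (8 * (2 * a - 1) * (2 - a) + 6 * a * (1 - b)) := by positivity
    have := mul_pos e2 e5
    linarith
end

section
/- For all real numbers a and b with 0 ≤ a < 1 and 0 ≤ b < 1, the following two identities hold: (i) 3·(1−b)·(3−a−b)²·(2−a) − ∫₀^{3−a−b} 3·(3−a−b−x)²·(2−a) dx = (3−a−b)²·(2−a)·(a−2b), so this quantity is nonnegative if and only if a ≥ 2b; (ii) 3·(3−a−b)²·(2−a) − ∫₀^{2−a} 3·(3−a−b)²·(2−a−x) dx = (3/2)·a·(3−a−b)²·(2−a), which is strictly positive whenever a > 0. -/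
/-- Case D5: computations of `β'_{(X,D)}(D₂)` and `β'_{(X,D)}(F)` for
`X = P¹ × P²`, `D₁ ∼ H + F`, `D₂ ∼ H`. -/
theorem stmt_4 (a b : ℝ) (ha0 : 0 ≤ a) (ha1 : a < 1) (hb0 : 0 ≤ b) (hb1 : b < 1) :
    (3 * (1 - b) * (3 - a - b) ^ 2 * (2 - a)
        - (∫ x in (0:ℝ)..(3 - a - b), 3 * (3 - a - b - x) ^ 2 * (2 - a))
      = (3 - a - b) ^ 2 * (2 - a) * (a - 2 * b)
      ∧ (0 ≤ (3 - a - b) ^ 2 * (2 - a) * (a - 2 * b) ↔ 2 * b ≤ a))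
    ∧ (3 * (3 - a - b) ^ 2 * (2 - a)
        - (∫ x in (0:ℝ)..(2 - a), 3 * (3 - a - b) ^ 2 * (2 - a - x))
      = (3 / 2) * a * (3 - a - b) ^ 2 * (2 - a)
      ∧ (0 < a → 0 < (3 / 2) * a * (3 - a - b) ^ 2 * (2 - a))) := by
  have hL : 0 < 3 - a - b := by linarith
  have hM : 0 < 2 - a := by linarith
  have hP : 0 < (3 - a - b) ^ 2 * (2 - a) := by positivity
  have h1 : (∫ x in (0:ℝ)..(3 - a - b), 3 * (3 - a - b - x) ^ 2 * (2 - a))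
      = (3 - a - b) ^ 3 * (2 - a) := by
    rw [intervalIntegral.integral_comp_sub_left (fun y => 3 * y ^ 2 * (2 - a)) (3 - a - b),
      intervalIntegral.integral_mul_const, intervalIntegral.integral_const_mul, integral_pow]
    push_cast
    ring
  have h2 : (∫ x in (0:ℝ)..(2 - a), 3 * (3 - a - b) ^ 2 * (2 - a - x))
      = 3 * (3 - a - b) ^ 2 * ((2 - a) ^ 2 / 2) := by
    rw [intervalIntegral.integral_const_mul,
      intervalIntegral.integral_comp_sub_left (fun y => y) (2 - a), integral_id]
    ring
  refine ⟨⟨by rw [h1]; ring, ?_⟩, by rw [h2]; ring, fun ha => by positivity⟩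
  rw [mul_nonneg_iff_of_pos_left hP, sub_nonneg]
end

section
/- Let k ≥ 0 and n ≥ 1 be integers and let a, b, c be real numbers with 0 ≤ a < 1, 0 ≤ b < 1, 0 ≤ c < 1 and (1−a)·k + (1−b)·n + c < 2. Then (k/3)·(−(1−3a−b)² − 4·(2−b−b²)) + n·((1+a−b)² − 4·(1−b+b²)) − 8·(a+b) + 4c·(a+b) < 0. -/
/-- Case D8: the estimate of `4(β'_{(X,D)}(D₁) + β'_{(X,D)}(D₂))/(3−a−b)²`
for `X = P_{P¹}(O ⊕ O(k) ⊕ O(n))`, `D = aD₁ + bD₂ + cD₃`, is strictly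
negative under the ampleness condition. -/
theorem stmt_6 (k n : ℕ) (hn : 1 ≤ n) (a b c : ℝ)
    (ha0 : 0 ≤ a) (ha1 : a < 1) (hb0 : 0 ≤ b) (hb1 : b < 1)
    (hc0 : 0 ≤ c) (hc1 : c < 1)
    (hamp : (1 - a) * (k : ℝ) + (1 - b) * (n : ℝ) + c < 2) :
    ((k : ℝ) / 3) * (-(1 - 3 * a - b) ^ 2 - 4 * (2 - b - b ^ 2))
      + (n : ℝ) * ((1 + a - b) ^ 2 - 4 * (1 - b + b ^ 2))
      - 8 * (a + b) + 4 * c * (a + b) < 0 := by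
  have hn' : (1 : ℝ) ≤ n := by exact_mod_cast hn
  have hk : (0 : ℝ) ≤ k := Nat.cast_nonneg k
  have h1 : 0 ≤ (a + b) * (2 - ((1 - a) * (k : ℝ) + (1 - b) * (n : ℝ) + c)) :=
    mul_nonneg (by linarith) (by linarith)
  have h2 : 0 < ((k : ℝ) + n) * ((3 - (a + b)) * (a + b + 1)) :=
    mul_pos (by linarith) (mul_pos (by linarith) (by linarith))
  linarith only [h1, h2]
end

section
/- Let m ≥ 1 be an integer and let a, b be real numbers with 0 ≤ a < 1 and 0 ≤ b < 1. Then (1−a)·(−4m·(2−a)³ + 6·(2−a)²·(2m+1−b)) − ∫₀^{2−a} (−4m·(2−a−x)³ + 6·(2−a−x)²·(2m+1−b)) dx = (2−a)²·(2 − 4a − 2b + 4ab − 3a²·m). -/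
/-- Case Q1: computation of the beta-invariant `β'_{(X,D)}(D₁)` for the
quadric bundle `X ⊂ P_{P¹}(O ⊕ O ⊕ O ⊕ O(m))`, `X ∼ 2H`, with boundary
`D = aD₁ + bD₂`, `D₁ ∼ H − mF`, `D₂ ∼ F`. -/
theorem stmt_7 (m : ℕ) (hm : 1 ≤ m) (a b : ℝ)
    (ha0 : 0 ≤ a) (ha1 : a < 1) (hb0 : 0 ≤ b) (hb1 : b < 1) :
    (1 - a) * (-4 * (m : ℝ) * (2 - a) ^ 3
        + 6 * (2 - a) ^ 2 * (2 * (m : ℝ) + 1 - b))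
      - ∫ x in (0:ℝ)..(2 - a),
          (-4 * (m : ℝ) * (2 - a - x) ^ 3
            + 6 * (2 - a - x) ^ 2 * (2 * (m : ℝ) + 1 - b))
    = (2 - a) ^ 2 * (2 - 4 * a - 2 * b + 4 * a * b - 3 * a ^ 2 * (m : ℝ)) := by
  have h : ∫ x in (0:ℝ)..(2 - a),
          (-4 * (m : ℝ) * (2 - a - x) ^ 3
            + 6 * (2 - a - x) ^ 2 * (2 * (m : ℝ) + 1 - b))
      = ((m : ℝ) * (2 - a - (2 - a)) ^ 4
            - 2 * (2 - a - (2 - a)) ^ 3 * (2 * (m : ℝ) + 1 - b))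
        - ((m : ℝ) * (2 - a - 0) ^ 4
            - 2 * (2 - a - 0) ^ 3 * (2 * (m : ℝ) + 1 - b)) := by
    refine intervalIntegral.integral_eq_sub_of_hasDerivAt
      (f := fun x : ℝ => (m : ℝ) * (2 - a - x) ^ 4
            - 2 * (2 - a - x) ^ 3 * (2 * (m : ℝ) + 1 - b)) ?_ ?_
    · intro x _
      have h1 : HasDerivAt (fun x : ℝ => 2 - a - x) (-1) x := by
        simpa using (hasDerivAt_id x).const_sub (2 - a)
      have h2 := ((h1.pow 4).const_mul (m : ℝ)).sub
        (((h1.pow 3).const_mul 2).mul_const (2 * (m : ℝ) + 1 - b))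
      refine h2.congr_deriv ?_
      norm_num
      ring
    · apply Continuous.intervalIntegrable
      fun_prop
  rw [h]
  ring
end

section
/- Let m ≥ 1 be an integer and let a, b be real numbers with 0 ≤ a < 1 and 0 ≤ b < 1. Then (1−b)·(−4m·(2−a)³ + 6·(2−a)²·(2m+1−b)) − ∫₀^{1+a·m−b} (−4m·(2−a)³ + 6·(2−a)²·(2m+1−b−x)) dx − (2−a)⁴·m²/2 = −(2−a)²·((4+4a+3a²)·m² − 6·(1−b)²)/2. Moreover, if m ≥ 2 then this quantity is strictly negative. -/
/-- Case Q1: computation of the beta-invariant `β'_{(X,D)}(D₂)` for the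
quadric bundle `X ⊂ P_{P¹}(O ⊕ O ⊕ O ⊕ O(m))`, `X ∼ 2H`, with boundary
`D = aD₁ + bD₂`; for `m ≥ 2` it is strictly negative. -/
theorem stmt_8 (m : ℕ) (hm : 1 ≤ m) (a b : ℝ)
    (ha0 : 0 ≤ a) (ha1 : a < 1) (hb0 : 0 ≤ b) (hb1 : b < 1) :
    (1 - b) * (-4 * (m : ℝ) * (2 - a) ^ 3
        + 6 * (2 - a) ^ 2 * (2 * (m : ℝ) + 1 - b))
      - (∫ x in (0:ℝ)..(1 + a * (m : ℝ) - b),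
          (-4 * (m : ℝ) * (2 - a) ^ 3
            + 6 * (2 - a) ^ 2 * (2 * (m : ℝ) + 1 - b - x)))
      - (2 - a) ^ 4 * (m : ℝ) ^ 2 / 2
    = -(2 - a) ^ 2 * ((4 + 4 * a + 3 * a ^ 2) * (m : ℝ) ^ 2 - 6 * (1 - b) ^ 2) / 2
    ∧ (2 ≤ m →
        -(2 - a) ^ 2 * ((4 + 4 * a + 3 * a ^ 2) * (m : ℝ) ^ 2 - 6 * (1 - b) ^ 2) / 2 < 0) := by
  have hint : (∫ x in (0:ℝ)..(1 + a * (m : ℝ) - b),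
          (-4 * (m : ℝ) * (2 - a) ^ 3
            + 6 * (2 - a) ^ 2 * (2 * (m : ℝ) + 1 - b - x)))
      = (-4 * (m : ℝ) * (2 - a) ^ 3 + 6 * (2 - a) ^ 2 * (2 * (m : ℝ) + 1 - b))
          * (1 + a * (m : ℝ) - b) - 3 * (2 - a) ^ 2 * (1 + a * (m : ℝ) - b) ^ 2 := by
    have key : ∀ x ∈ Set.uIcc (0:ℝ) (1 + a * (m : ℝ) - b), HasDerivAt
        (fun x : ℝ => (-4 * (m : ℝ) * (2 - a) ^ 3
          + 6 * (2 - a) ^ 2 * (2 * (m : ℝ) + 1 - b)) * x - 3 * (2 - a) ^ 2 * x ^ 2)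
        (-4 * (m : ℝ) * (2 - a) ^ 3
            + 6 * (2 - a) ^ 2 * (2 * (m : ℝ) + 1 - b - x)) x := by
      intro x _
      have h := ((hasDerivAt_id' x).const_mul (-4 * (m : ℝ) * (2 - a) ^ 3
          + 6 * (2 - a) ^ 2 * (2 * (m : ℝ) + 1 - b))).sub
          ((hasDerivAt_pow 2 x).const_mul (3 * (2 - a) ^ 2))
      refine h.congr_deriv ?_
      norm_num
      ring
    rw [intervalIntegral.integral_eq_sub_of_hasDerivAt key
      (Continuous.intervalIntegrable (by fun_prop) _ _)]
    ring
  refine ⟨by rw [hint]; ring, fun h2 => ?_⟩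
  have hm2 : (2:ℝ) ≤ m := by exact_mod_cast h2
  have h4 : (4:ℝ) ≤ (m:ℝ) ^ 2 := by nlinarith
  have hb : (1 - b) ^ 2 ≤ 1 := by nlinarith
  have h16 : 4 * (4:ℝ) ≤ (4 + 4 * a + 3 * a ^ 2) * (m : ℝ) ^ 2 :=
    mul_le_mul (by nlinarith [sq_nonneg a]) h4 (by norm_num) (by positivity)
  have hp : 0 < (2 - a) ^ 2 := pow_pos (by linarith) 2
  have := mul_pos hp (show 0 < (4 + 4 * a + 3 * a ^ 2) * (m : ℝ) ^ 2 - 6 * (1 - b) ^ 2 by linarith)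
  linarith
end

section
/- Let k ≥ 1 be an integer and let a, b, c be real numbers with 0 ≤ a < 1, 0 ≤ b < 1, 0 ≤ c < 1 and k + b + c < 3 + a·k. Then (1−a)·(k+3−b−c)³ − (1−a)·(a·k−k+3−b−c)³ − (2−a)·(k+3−b−c)³ + (k+3−b−c)⁴/(4k) − (a·k−k+3−b−c)⁴/(4k) < 0. -/
/-- Case C2: `k·β'_{(X,D)}(D₁)` for `X = P_{P²}(O ⊕ O(k))` with boundary
`D = aD₁ + bD₂ + cD₃` is strictly negative under the ampleness condition. -/
theorem stmt_10 (k : ℕ) (hk : 1 ≤ k) (a b c : ℝ)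
    (ha0 : 0 ≤ a) (ha1 : a < 1) (hb0 : 0 ≤ b) (hb1 : b < 1)
    (hc0 : 0 ≤ c) (hc1 : c < 1)
    (hamp : (k : ℝ) + b + c < 3 + a * (k : ℝ)) :
    (1 - a) * ((k : ℝ) + 3 - b - c) ^ 3
      - (1 - a) * (a * (k : ℝ) - (k : ℝ) + 3 - b - c) ^ 3
      - (2 - a) * ((k : ℝ) + 3 - b - c) ^ 3
      + ((k : ℝ) + 3 - b - c) ^ 4 / (4 * (k : ℝ))
      - (a * (k : ℝ) - (k : ℝ) + 3 - b - c) ^ 4 / (4 * (k : ℝ)) < 0 := by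
  have hk0 : (1 : ℝ) ≤ (k : ℝ) := by exact_mod_cast hk
  generalize (k : ℝ) = K at *
  obtain ⟨q, hq⟩ : ∃ q, q = a * K - K + 3 - b - c := ⟨_, rfl⟩
  obtain ⟨p, hp⟩ : ∃ p, p = K + 3 - b - c := ⟨_, rfl⟩
  rw [← hq, ← hp]
  have hq0 : 0 < q := by linarith
  have hpq : p = q + (2 - a) * K := by rw [hq, hp]; ring
  have hlt : q < p := by nlinarith
  have hdiv : p ^ 4 / (4 * K) - q ^ 4 / (4 * K)
      = (2 - a) / 4 * (p ^ 3 + p ^ 2 * q + p * q ^ 2 + q ^ 3) := by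
    rw [← sub_div, div_eq_iff (by positivity)]
    have h : (2 - a) * K = p - q := by linarith
    linear_combination (-(p ^ 3 + p ^ 2 * q + p * q ^ 2 + q ^ 3)) * h
  have h1 : 0 ≤ a * ((p - q) * (3 * p ^ 2 + 2 * p * q + q ^ 2)) := by
    have := sub_pos.2 hlt
    have hp0 : 0 < p := hq0.trans hlt
    positivity
  have h2 : 0 < (1 - a) * ((p - q) ^ 2 * (p + q)) := by
    have := sub_pos.2 hlt
    have := sub_pos.2 ha1
    have hp0 : 0 < p := hq0.trans hlt
    positivity
  linear_combination hdiv + h1 / 4 + h2 / 2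
end

section
/- For all real numbers a and b with 0 ≤ a < 1 and 0 ≤ b < 1, one has 19a³ + 32a²b − 174a² + 6ab² − 140ab + 468a + 104b − 344 < 0. -/
/-- Case C3: the polynomial factor of `β'_{(X,D)}(E)` for
`X = P_{P²}(O ⊕ O(1))`, `E ∼ H − F`, is strictly negative for all
boundary coefficients `0 ≤ a, b < 1`. -/
theorem stmt_11 (a b : ℝ) (ha0 : 0 ≤ a) (ha1 : a < 1) (hb0 : 0 ≤ b) (hb1 : b < 1) :
    19 * a ^ 3 + 32 * a ^ 2 * b - 174 * a ^ 2 + 6 * a * b ^ 2 - 140 * a * b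
      + 468 * a + 104 * b - 344 < 0 := by
  have h0 : 19*a^3 - 174*a^2 + 468*a - 344 < 0 := by
    nlinarith [mul_nonneg ha0 (sub_nonneg.2 ha1.le), mul_nonneg (mul_nonneg ha0 ha0) (sub_nonneg.2 ha1.le), sq_nonneg (1-a), mul_nonneg (sq_nonneg (1-a)) ha0]
  have h1 : 19*a^3 - 142*a^2 + 334*a - 240 < 0 := by
    nlinarith [mul_nonneg ha0 (sub_nonneg.2 ha1.le), mul_nonneg (mul_nonneg ha0 ha0) (sub_nonneg.2 ha1.le), sq_nonneg (1-a), mul_nonneg (sq_nonneg (1-a)) ha0]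
  have h2 : 0 ≤ a * (b * (1 - b)) := mul_nonneg ha0 (mul_nonneg hb0 (sub_nonneg.2 hb1.le))
  have h3 := mul_pos_of_neg_of_neg h0 (sub_neg.2 hb1)
  have h4 := mul_nonneg (neg_pos.2 h1).le hb0
  nlinarith [h2, h3, h4]
end

section
/- Let k, n, m ≥ 0 be integers and let a, b, c be real numbers with 0 < a < 1, 0 ≤ b < 1, 0 ≤ c < 1, k·(1−a) < 2−b and m·(1−a) + n·(1−b) < 2−c. Write P = 2+k−b and Q = 2+n+k·n+m−c. Then (1−a)·(2−a)³·(n·k²+2k·m) + 6·(1−a)·(2−a)·P·Q − 3n·(1−a)·P²·(2−a) − 3k·(1−a)·(2−a)²·Q − 3m·(1−a)·(2−a)²·P − (2−a)⁴·(n·k²+2k·m)/4 − 3·(2−a)²·P·Q + (3n/2)·(2−a)²·P² + k·(2−a)³·Q + m·(2−a)³·P < 0. -/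
/-- Case C5: the beta-invariant `β'_{(X,D)}(D₁)` for
`X = P_{F_n}(O ⊕ O(ks + (kn+m)f))` with boundary `D = aD₁ + bD₂ + cD₃`
is strictly negative under the ampleness conditions. -/
theorem stmt_12 (k n m : ℕ) (a b c : ℝ)
    (ha0 : 0 < a) (ha1 : a < 1) (hb0 : 0 ≤ b) (hb1 : b < 1)
    (hc0 : 0 ≤ c) (hc1 : c < 1)
    (hamp1 : (k : ℝ) * (1 - a) < 2 - b)
    (hamp2 : (m : ℝ) * (1 - a) + (n : ℝ) * (1 - b) < 2 - c)
    (P Q : ℝ)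
    (hP : P = 2 + (k : ℝ) - b)
    (hQ : Q = 2 + (n : ℝ) + (k : ℝ) * (n : ℝ) + (m : ℝ) - c) :
    (1 - a) * (2 - a) ^ 3 * ((n : ℝ) * (k : ℝ) ^ 2 + 2 * (k : ℝ) * (m : ℝ))
      + 6 * (1 - a) * (2 - a) * P * Q
      - 3 * (n : ℝ) * (1 - a) * P ^ 2 * (2 - a)
      - 3 * (k : ℝ) * (1 - a) * (2 - a) ^ 2 * Q
      - 3 * (m : ℝ) * (1 - a) * (2 - a) ^ 2 * P
      - (2 - a) ^ 4 * ((n : ℝ) * (k : ℝ) ^ 2 + 2 * (k : ℝ) * (m : ℝ)) / 4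
      - 3 * (2 - a) ^ 2 * P * Q
      + (3 * (n : ℝ) / 2) * (2 - a) ^ 2 * P ^ 2
      + (k : ℝ) * (2 - a) ^ 3 * Q
      + (m : ℝ) * (2 - a) ^ 3 * P < 0 := by
  have hk : (0:ℝ) ≤ k := Nat.cast_nonneg k
  have hn : (0:ℝ) ≤ n := Nat.cast_nonneg n
  have hm : (0:ℝ) ≤ m := Nat.cast_nonneg m
  generalize (k:ℝ) = k at *
  generalize (n:ℝ) = n at *
  generalize (m:ℝ) = m at *
  -- write `u = 1 - a`, `p = p(t)`, `r = q(t) - n p(t)` with `t = 2 - a`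
  obtain ⟨u, hu⟩ : ∃ u, u = 1 - a := ⟨_, rfl⟩
  obtain ⟨p, hp⟩ : ∃ p, p = 2 - b - k * (1 - a) := ⟨_, rfl⟩
  obtain ⟨r, hr⟩ : ∃ r, r = 2 - c - n * (1 - b) - m * (1 - a) := ⟨_, rfl⟩
  have hp0 : 0 < p := by linarith
  have hr0 : 0 < r := by linarith
  have hu0 : 0 < u := by linarith
  have hu1 : u < 1 := by linarith
  have ea : a = 1 - u := by linarith
  have hP' : P = p + k * (1 + u) := by rw [hP, hp, hu]; ring
  have hQ' : Q = r + n * p + (k * n + m) * (1 + u) := by rw [hQ, hp, hr, hu]; ring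
  have hV : 0 < (p + k * u) * (n * (p + k * u) + 2 * (r + m * u)) := by positivity
  have hJ : 0 < (u ^ 3 + 1) / 3 := by positivity
  have hS : 0 ≤ 2 * k * (n * p + r) + 2 * m * p := by positivity
  have hW : 0 ≤ n * k ^ 2 + 2 * k * m := by positivity
  have hu4 : u ^ 4 < 1 := pow_lt_one₀ hu0.le hu1 (by norm_num)
  have h1 : 0 < (p + k * u) * (n * (p + k * u) + 2 * (r + m * u)) * ((1 + u) * (1 - u) / 2) :=
    mul_pos hV (by nlinarith)
  have h2 := mul_nonneg hS hJ.le
  have h3 : 0 ≤ (n * k ^ 2 + 2 * k * m) * ((1 - u ^ 4) / 4 + 2 * u * ((u ^ 3 + 1) / 3)) :=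
    mul_nonneg hW (by have := mul_pos hu0 hJ; linarith)
  clear hp hr hu hP hQ
  subst ea hP' hQ'
  linarith only [h1, h2, h3]
end

section
/- Let k, n ≥ 0 be integers and let a, b be real numbers with 0 ≤ a < 1 and 0 ≤ b < 1, such that a > 0 or k ≥ 1 or n ≥ 1. Then −(3/2)·a·k·n·(2−a)³ + n·(2−a)·(2+k−b)·(−2a²+2a−2) + k·(2−a)·(2+n−b)·(−2a²+2a−2) − 3a·(2−a)·(2+k−b)·(2−b) − 3a·(2−a)·(2−b)·(2+n−b) < 0. -/
/-- Case C7: the beta-invariant `β'_{(X,D)}(D₁)` for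
`X = P_{P¹×P¹}(O ⊕ O(k,n))` with boundary `D = aD₁ + bD₂` is strictly
negative unless `a = k = n = 0`. -/
theorem stmt_13 (k n : ℕ) (a b : ℝ)
    (ha0 : 0 ≤ a) (ha1 : a < 1) (hb0 : 0 ≤ b) (hb1 : b < 1)
    (hne : 0 < a ∨ 1 ≤ k ∨ 1 ≤ n) :
    -(3 / 2) * a * (k : ℝ) * (n : ℝ) * (2 - a) ^ 3
      + (n : ℝ) * (2 - a) * (2 + (k : ℝ) - b) * (-2 * a ^ 2 + 2 * a - 2)
      + (k : ℝ) * (2 - a) * (2 + (n : ℝ) - b) * (-2 * a ^ 2 + 2 * a - 2)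
      - 3 * a * (2 - a) * (2 + (k : ℝ) - b) * (2 - b)
      - 3 * a * (2 - a) * (2 - b) * (2 + (n : ℝ) - b) < 0 := by
  have hk : (0 : ℝ) ≤ k := Nat.cast_nonneg k
  have hn : (0 : ℝ) ≤ n := Nat.cast_nonneg n
  have hA : 0 < 2 - a := by linarith
  have hB : 0 < 2 - b := by linarith
  have hK : 0 < 2 + (k : ℝ) - b := by linarith
  have hN : 0 < 2 + (n : ℝ) - b := by linarith
  have hQ : 0 < 2 * a ^ 2 - 2 * a + 2 := by nlinarith [sq_nonneg (a - 1)]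
  have h1 : 0 ≤ 3 / 2 * a * (k : ℝ) * (n : ℝ) * (2 - a) ^ 3 := by positivity
  have h2 : 0 ≤ (n : ℝ) * ((2 - a) * (2 + (k : ℝ) - b) * (2 * a ^ 2 - 2 * a + 2)) :=
    mul_nonneg hn (mul_pos (mul_pos hA hK) hQ).le
  have h3 : 0 ≤ (k : ℝ) * ((2 - a) * (2 + (n : ℝ) - b) * (2 * a ^ 2 - 2 * a + 2)) :=
    mul_nonneg hk (mul_pos (mul_pos hA hN) hQ).le
  have h4 : 0 ≤ a * ((2 - a) * (2 + (k : ℝ) - b) * (2 - b)) :=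
    mul_nonneg ha0 (mul_pos (mul_pos hA hK) hB).le
  have h5 : 0 ≤ a * ((2 - a) * (2 - b) * (2 + (n : ℝ) - b)) :=
    mul_nonneg ha0 (mul_pos (mul_pos hA hB) hN).le
  rcases hne with h | h | h
  · have h6 := mul_pos h (mul_pos (mul_pos hA hK) hB)
    linarith
  · have h' : (0 : ℝ) < k := by exact_mod_cast h
    have h6 := mul_pos h' (mul_pos (mul_pos hA hN) hQ)
    linarith
  · have h' : (0 : ℝ) < n := by exact_mod_cast h
    have h6 := mul_pos h' (mul_pos (mul_pos hA hK) hQ)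
    linarith
end

section
/- For all real numbers a and b with 0 ≤ a < 1 and 0 ≤ b < 1, one has (1−b)·(12·(1+a−b)·(2−a) + 6·(2−a)² − 3·(1+a−b)²·(2−a)) − ∫₀^{1+a−b} (12·(1+a−b−t)·(2−a) + 6·(2−a)² − 3·(1+a−b−t)²·(2−a)) dt − ∫_{1+a−b}^{3−b} 6·(3−b−t)² dt = (2−a)·(−a²·(2−a) − 2·(2−b)·(1+b)² − a·(7−6b+3b²)), and this quantity is strictly negative. -/
/-- Case C10: computation of the beta-invariant `β'_{(X,D)}(D₂)` for
`X = P_{F₁}(f*T_{P²})` (Fano threefold 3.24) with boundary `D = aD₁ + bD₂`,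
`D₁ ∼ H − E`, `D₂ ∼ E`; it is strictly negative. -/
theorem stmt_16 (a b : ℝ) (ha0 : 0 ≤ a) (ha1 : a < 1) (hb0 : 0 ≤ b) (hb1 : b < 1) :
    (1 - b) * (12 * (1 + a - b) * (2 - a) + 6 * (2 - a) ^ 2
        - 3 * (1 + a - b) ^ 2 * (2 - a))
      - (∫ t in (0:ℝ)..(1 + a - b),
          (12 * (1 + a - b - t) * (2 - a) + 6 * (2 - a) ^ 2
            - 3 * (1 + a - b - t) ^ 2 * (2 - a)))
      - (∫ t in (1 + a - b)..(3 - b), 6 * (3 - b - t) ^ 2)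
    = (2 - a) * (-a ^ 2 * (2 - a) - 2 * (2 - b) * (1 + b) ^ 2
        - a * (7 - 6 * b + 3 * b ^ 2))
    ∧ (2 - a) * (-a ^ 2 * (2 - a) - 2 * (2 - b) * (1 + b) ^ 2
        - a * (7 - 6 * b + 3 * b ^ 2)) < 0 := by
  have h1 : (∫ t in (0:ℝ)..(1 + a - b),
          (12 * (1 + a - b - t) * (2 - a) + 6 * (2 - a) ^ 2
            - 3 * (1 + a - b - t) ^ 2 * (2 - a)))
      = 6 * (1 + a - b) ^ 2 * (2 - a) + 6 * (2 - a) ^ 2 * (1 + a - b)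
        - (1 + a - b) ^ 3 * (2 - a) := by
    rw [intervalIntegral.integral_eq_sub_of_hasDerivAt
      (f := fun t => -6 * (1 + a - b - t) ^ 2 * (2 - a) + 6 * (2 - a) ^ 2 * t
        + (1 + a - b - t) ^ 3 * (2 - a))]
    · ring
    · intro t _
      have hd : HasDerivAt (fun t : ℝ => 1 + a - b - t) (-1) t :=
        (hasDerivAt_id t).const_sub (1 + a - b)
      have h := ((((hd.pow 2).const_mul (-6)).mul_const (2 - a)).add
        ((hasDerivAt_id t).const_mul (6 * (2 - a) ^ 2))).add ((hd.pow 3).mul_const (2 - a))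
      refine h.congr_deriv ?_
      norm_num
      ring
    · exact Continuous.intervalIntegrable (by fun_prop) _ _
  have h2 : (∫ t in (1 + a - b)..(3 - b), 6 * (3 - b - t) ^ 2) = 2 * (2 - a) ^ 3 := by
    rw [intervalIntegral.integral_eq_sub_of_hasDerivAt
      (f := fun t => -2 * (3 - b - t) ^ 3)]
    · ring
    · intro t _
      have hd : HasDerivAt (fun t : ℝ => 3 - b - t) (-1) t :=
        (hasDerivAt_id t).const_sub (3 - b)
      refine ((hd.pow 3).const_mul (-2)).congr_deriv ?_
      norm_num
      ring
    · exact Continuous.intervalIntegrable (by fun_prop) _ _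
  constructor
  · rw [h1, h2]
    ring
  · apply mul_neg_of_pos_of_neg (by linarith)
    have e1 : 0 ≤ a ^ 2 * (2 - a) := mul_nonneg (sq_nonneg a) (by linarith)
    have e2 : 0 < (2 - b) * (1 + b) ^ 2 := mul_pos (by linarith) (by positivity)
    have e3 : 0 ≤ a * (7 - 6 * b + 3 * b ^ 2) := mul_nonneg ha0 (by nlinarith [sq_nonneg b])
    linarith
end

section
/- Let n ≥ 1 be an integer and let a, b be real numbers with 0 ≤ a < 1, 0 ≤ b < 1 and a + n·(1−b) < 2. Then 16 + 4a³ − a⁴ − 4a·(4−b)·(1−b)² − 36b·(2−n) − 27n − 3b⁴·n + 4b³·(5n−2) − 6b²·(7n−8) < 0. -/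
/-- Case E2: twice the beta-invariant `β'_{(X,D)}(D₂)` for `X` the blow-up
at a point of `P_{P¹}(O ⊕ O ⊕ O(n))` with boundary `D = aD₁ + bD₂` is
strictly negative under the ampleness condition. -/
theorem stmt_17 (n : ℕ) (hn : 1 ≤ n) (a b : ℝ)
    (ha0 : 0 ≤ a) (ha1 : a < 1) (hb0 : 0 ≤ b) (hb1 : b < 1)
    (hamp : a + (n : ℝ) * (1 - b) < 2) :
    16 + 4 * a ^ 3 - a ^ 4 - 4 * a * (4 - b) * (1 - b) ^ 2
      - 36 * b * (2 - (n : ℝ)) - 27 * (n : ℝ) - 3 * b ^ 4 * (n : ℝ)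
      + 4 * b ^ 3 * (5 * (n : ℝ) - 2) - 6 * b ^ 2 * (7 * (n : ℝ) - 8) < 0 := by
  have hN : (1 : ℝ) ≤ (n : ℝ) := by exact_mod_cast hn
  have hc : 0 ≤ 1 - b := by linarith
  have h1 : 4 * a ^ 3 - a ^ 4 ≤ 3 := by
    have h2 : a ^ 3 ≤ 1 := pow_le_one₀ ha0 ha1.le
    nlinarith [mul_nonneg (sub_nonneg.2 ha1.le) (sub_nonneg.2 h2), sq_nonneg (a ^ 2 - 1),
      sq_nonneg (a - 1), mul_nonneg (sq_nonneg (a - 1)) (sq_nonneg (a - 1)),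
      mul_nonneg (sub_nonneg.2 ha1.le) (pow_nonneg ha0 3),
      mul_nonneg (sub_nonneg.2 ha1.le) (pow_nonneg ha0 2)]
  have h3 : 0 ≤ 4 * a * (4 - b) * (1 - b) ^ 2 := by
    have : 0 ≤ 4 - b := by linarith
    positivity
  -- the coefficient of `n` is at most `-16`
  have hk : -27 + 36 * b - 42 * b ^ 2 + 20 * b ^ 3 - 3 * b ^ 4 ≤ -16 := by
    have e : -27 + 36 * b - 42 * b ^ 2 + 20 * b ^ 3 - 3 * b ^ 4 + 16
        = -((1 - b) ^ 3 * (8 + 3 * (1 - b))) := by ring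
    have : 0 ≤ (1 - b) ^ 3 * (8 + 3 * (1 - b)) := by positivity
    linarith
  have h4 := mul_nonneg (sub_nonneg.2 hN) (sub_nonneg.2 hk)
  have h5 : b ^ 2 ≤ b := by nlinarith
  have h6 : b ^ 3 ≤ b := by nlinarith
  have h7 : 0 ≤ b ^ 4 := by positivity
  nlinarith
end
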